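/- Let n ≥ 5 be an integer and let λ > n³(n−4)/16. Then there is no smooth positive radial solution u of Δ²u = λ·u^{(n+4)/(n−4)} on the open unit ball B₁ ⊂ ℝⁿ, smooth up to the boundary, with u = 1 and ∂_ν u = −(n−4)/2 on ∂B₁. -/

import Mathlib

open Metric Real

/-- The Euclidean Laplacian of a function on `ℝⁿ`, as the sum of pure second
derivatives in the coordinate directions. -/
noncomputable def laplacian {n : ℕ} (u : EuclideanSpace ℝ (Fin n) → ℝ)
    (x : EuclideanSpace ℝ (Fin n)) : ℝ :=
  ∑ i : Fin n, iteratedFDeriv ℝ 2 u x ![EuclideanSpace.single i 1, EuclideanSpace.single i 1]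

/-- The norm of a real inner product space is differentiable away from the origin. -/
theorem hasFDerivAt_norm_of_ne_zero {E : Type*} [NormedAddCommGroup E] [InnerProductSpace ℝ E]
    {x : E} (hx : x ≠ 0) :
    HasFDerivAt (fun y : E => ‖y‖) ((‖x‖⁻¹ : ℝ) • innerSL ℝ x) x := by
  have h := (hasStrictFDerivAt_norm_sq x).hasFDerivAt.sqrt (by simpa using hx)
  simp only [Real.sqrt_sq (norm_nonneg _)] at h
  refine h.congr_fderiv ?_
  ext v
  have : ‖x‖ ≠ 0 := norm_ne_zero_iff.mpr hx
  simp
  field_simp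

/-- The chain rule for a function of the radius. -/
theorem HasDerivAt.hasFDerivAt_comp_norm {E : Type*} [NormedAddCommGroup E]
    [InnerProductSpace ℝ E] {g : ℝ → ℝ} {g' : ℝ} {x : E} (hg : HasDerivAt g g' ‖x‖)
    (hx : x ≠ 0) :
    HasFDerivAt (fun y : E => g ‖y‖) ((g' / ‖x‖) • innerSL ℝ x) x := by
  refine (hg.comp_hasFDerivAt x (hasFDerivAt_norm_of_ne_zero hx)).congr_fderiv ?_
  rw [smul_smul, div_eq_mul_inv]

/-- The second derivative of a function of the radius in a direction `v`. -/
theorem fderiv_fderiv_of_radial {E : Type*} [NormedAddCommGroup E] [InnerProductSpace ℝ E]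
    {u : E → ℝ} {φ : ℝ → ℝ} (hu : ContDiff ℝ 2 u) (hφ : ContDiff ℝ 2 φ)
    (huφ : ∀ x, u x = φ ‖x‖) {x : E} (hx : x ≠ 0) (v : E) :
    fderiv ℝ (fderiv ℝ u) x v v =
      (deriv (deriv φ) ‖x‖ / ‖x‖ ^ 2 - deriv φ ‖x‖ / ‖x‖ ^ 3) * inner ℝ x v ^ 2
        + deriv φ ‖x‖ / ‖x‖ * ‖v‖ ^ 2 := by
  have hr : ‖x‖ ≠ 0 := norm_ne_zero_iff.mpr hx
  obtain rfl : u = fun y => φ ‖y‖ := funext huφ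
  have hφ' : HasDerivAt (deriv φ) (deriv (deriv φ) ‖x‖) ‖x‖ :=
    ((hφ.iterate_deriv' 1 1).differentiable one_ne_zero _).hasDerivAt
  have hquot : HasDerivAt (fun r => deriv φ r / r)
      ((deriv (deriv φ) ‖x‖ * ‖x‖ - deriv φ ‖x‖ * 1) / ‖x‖ ^ 2) ‖x‖ :=
    hφ'.fun_div (hasDerivAt_id _) hr
  have hfst : (fun y => fderiv ℝ (fun y : E => φ ‖y‖) y v) =ᶠ[nhds x]
      fun y => (deriv φ ‖y‖ / ‖y‖) * inner ℝ y v := by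
    filter_upwards [isOpen_ne.mem_nhds hx] with y hy
    have h := ((hφ.differentiable two_ne_zero ‖y‖).hasDerivAt).hasFDerivAt_comp_norm hy
    simp [h.fderiv]
  have hinner : HasFDerivAt (fun y : E => inner ℝ y v) (innerSL ℝ v) x := by
    simpa [real_inner_comm] using (innerSL ℝ v).hasFDerivAt (x := x)
  have hsnd := ((hquot.hasFDerivAt_comp_norm hx).fun_mul hinner).congr_of_eventuallyEq hfst
  have hd : DifferentiableAt ℝ (fderiv ℝ (fun y : E => φ ‖y‖)) x :=
    (hu.fderiv_right (m := 1) le_rfl).differentiable one_ne_zero x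
  have happ := (hd.hasFDerivAt.clm_apply (hasFDerivAt_const v x)).unique hsnd
  have := congrArg (fun L : E →L[ℝ] ℝ => L v) happ
  simp at this
  rw [this]
  field_simp
  ring

/-- The Laplacian of a function of the radius, away from the origin. -/
theorem laplacian_of_radial {n : ℕ} {u : EuclideanSpace ℝ (Fin n) → ℝ} {φ : ℝ → ℝ}
    (hu : ContDiff ℝ 2 u) (hφ : ContDiff ℝ 2 φ) (huφ : ∀ x, u x = φ ‖x‖)
    {x : EuclideanSpace ℝ (Fin n)} (hx : x ≠ 0) :
    laplacian u x = deriv (deriv φ) ‖x‖ + (n - 1) * deriv φ ‖x‖ / ‖x‖ := by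
  have hr : ‖x‖ ≠ 0 := norm_ne_zero_iff.mpr hx
  simp only [laplacian, iteratedFDeriv_two_apply, Matrix.cons_val_zero, Matrix.cons_val_one,
    fderiv_fderiv_of_radial hu hφ huφ hx, Finset.sum_add_distrib, ← Finset.mul_sum]
  simp only [EuclideanSpace.inner_single_right, one_mul, conj_trivial,
    ← EuclideanSpace.real_norm_sq_eq, PiLp.norm_single, norm_one, one_pow,
    Finset.sum_const, Finset.card_univ, Fintype.card_fin, nsmul_eq_mul, mul_one]
  field_simp
  ring

theorem contDiff_laplacian {n : ℕ} {u : EuclideanSpace ℝ (Fin n) → ℝ}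
    (hu : ContDiff ℝ (⊤ : ℕ∞) u) : ContDiff ℝ (⊤ : ℕ∞) (laplacian u) := by
  unfold laplacian
  simp only [iteratedFDeriv_two_apply]
  have h : ContDiff ℝ (⊤ : ℕ∞) (fderiv ℝ (fderiv ℝ u)) :=
    (hu.fderiv_right (m := (⊤ : ℕ∞)) le_rfl).fderiv_right le_rfl
  exact ContDiff.sum fun i _ => (h.clm_apply contDiff_const).clm_apply contDiff_const

/-- The Pohozaev energy of a radial function `φ` with Laplacian `w`. -/
noncomputable def pohozaevEnergy (n : ℕ) (lam : ℝ) (φ w : ℝ → ℝ) (r : ℝ) : ℝ :=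
  r ^ n * (deriv φ r * deriv w r - w r ^ 2 / 2
      - lam * (((n : ℝ) - 4) / (2 * n)) * φ r ^ (2 * (n : ℝ) / ((n : ℝ) - 4)))
    + r ^ (n - 1) * (((n : ℝ) - 4) / 2 * (φ r * deriv w r) + n / 2 * (deriv φ r * w r))

/-- The Pohozaev energy is conserved along radial solutions of the critical biharmonic equation. -/
theorem hasDerivAt_pohozaevEnergy {n : ℕ} (hn : 5 ≤ n) {lam : ℝ} {φ w : ℝ → ℝ}
    (hφ : ContDiff ℝ 2 φ) (hw : ContDiff ℝ 2 w) {r : ℝ} (hr : 0 < r) (hpos : 0 < φ r)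
    (hφw : w r = deriv (deriv φ) r + (n - 1) * deriv φ r / r)
    (heq : deriv (deriv w) r + (n - 1) * deriv w r / r =
      lam * φ r ^ (((n : ℝ) + 4) / ((n : ℝ) - 4))) :
    HasDerivAt (pohozaevEnergy n lam φ w) 0 r := by
  have hn4 : (n : ℝ) - 4 ≠ 0 := by
    have : (5 : ℝ) ≤ n := by exact_mod_cast hn
    linarith
  have hn0 : (n : ℝ) ≠ 0 := by
    have : n ≠ 0 := by omega
    exact_mod_cast this
  have dφ : HasDerivAt φ (deriv φ r) r := (hφ.differentiable two_ne_zero r).hasDerivAt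
  have dw : HasDerivAt w (deriv w r) r := (hw.differentiable two_ne_zero r).hasDerivAt
  have dφ' : HasDerivAt (deriv φ) (deriv (deriv φ) r) r :=
    ((hφ.iterate_deriv' 1 1).differentiable one_ne_zero r).hasDerivAt
  have dw' : HasDerivAt (deriv w) (deriv (deriv w) r) r :=
    ((hw.iterate_deriv' 1 1).differentiable one_ne_zero r).hasDerivAt
  have dpow := dφ.rpow_const (p := 2 * (n : ℝ) / ((n : ℝ) - 4)) (Or.inl hpos.ne')
  have hexp : 2 * (n : ℝ) / ((n : ℝ) - 4) - 1 = ((n : ℝ) + 4) / ((n : ℝ) - 4) := by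
    field_simp
    ring
  have hsplit : φ r ^ (2 * (n : ℝ) / ((n : ℝ) - 4)) =
      φ r ^ (((n : ℝ) + 4) / ((n : ℝ) - 4)) * φ r := by
    rw [← hexp, Real.rpow_sub_one hpos.ne']
    field_simp
  rw [hexp] at dpow
  have key := ((hasDerivAt_pow n r).fun_mul
      (((dφ'.fun_mul dw').fun_sub ((dw.fun_pow 2).div_const 2)).fun_sub
        (dpow.const_mul (lam * (((n : ℝ) - 4) / (2 * n)))))).fun_add
    ((hasDerivAt_pow (n - 1) r).fun_mul
      (((dφ.fun_mul dw').const_mul (((n : ℝ) - 4) / 2)).fun_add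
        ((dφ'.fun_mul dw).const_mul ((n : ℝ) / 2))))
  refine key.congr_deriv ?_
  have e1 : deriv (deriv φ) r = w r - (n - 1) * deriv φ r / r := by linarith
  have e2 : deriv (deriv w) r = lam * φ r ^ (((n : ℝ) + 4) / ((n : ℝ) - 4))
      - (n - 1) * deriv w r / r := by linarith
  rw [e1, e2, hsplit]
  generalize φ r ^ (((n : ℝ) + 4) / ((n : ℝ) - 4)) = P
  obtain ⟨k, rfl⟩ : ∃ k, n = k + 2 := ⟨n - 2, by omega⟩
  have hk : k + 2 - 1 = k + 1 := rfl
  rw [hk]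
  simp only [Nat.add_sub_cancel]
  push_cast at hn0 hn4 ⊢
  field_simp
  ring

/-- The Pohozaev energy of a regular radial solution on the unit ball vanishes at the boundary. -/
theorem pohozaevEnergy_one_eq_zero {n : ℕ} (hn : 5 ≤ n) {lam : ℝ} {φ w : ℝ → ℝ}
    (hφ : ContDiff ℝ 2 φ) (hw : ContDiff ℝ 2 w) (hpos : ∀ r ∈ Set.Icc (0 : ℝ) 1, 0 < φ r)
    (hφw : ∀ r ∈ Set.Ioo (0 : ℝ) 1, w r = deriv (deriv φ) r + (n - 1) * deriv φ r / r)
    (heq : ∀ r ∈ Set.Ioo (0 : ℝ) 1, deriv (deriv w) r + (n - 1) * deriv w r / r =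
      lam * φ r ^ (((n : ℝ) + 4) / ((n : ℝ) - 4))) :
    pohozaevEnergy n lam φ w 1 = 0 := by
  have hcont : ContinuousOn (pohozaevEnergy n lam φ w) (Set.Icc 0 1) := by
    have c1 : Continuous (deriv φ) := hφ.continuous_deriv one_le_two
    have c2 : Continuous (deriv w) := hw.continuous_deriv one_le_two
    have c3 := hφ.continuous
    have c4 := hw.continuous
    have c5 : ContinuousOn (fun r => φ r ^ (2 * (n : ℝ) / ((n : ℝ) - 4))) (Set.Icc 0 1) :=
      c3.continuousOn.rpow_const fun r hr => Or.inl (hpos r hr).ne'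
    unfold pohozaevEnergy
    fun_prop
  obtain ⟨c, -, hc⟩ := exists_hasDerivAt_eq_slope (pohozaevEnergy n lam φ w) (fun _ => 0)
    zero_lt_one hcont fun r hr => hasDerivAt_pohozaevEnergy hn hφ hw hr.1
      (hpos r (Set.Ioo_subset_Icc_self hr)) (hφw r hr) (heq r hr)
  have hzero : pohozaevEnergy n lam φ w 0 = 0 := by
    simp [pohozaevEnergy, show n ≠ 0 by omega, show n - 1 ≠ 0 by omega]
  rw [hzero] at hc
  simpa using hc.symm

/-- Nonexistence for the problem `(P_λ)` of the paper when `λ > n³(n-4)/16`: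
there is no smooth positive radial solution of `Δ²u = λ u^{(n+4)/(n-4)}` on the
unit ball with `u = 1` and `∂_ν u = -(n-4)/2` on the unit sphere. -/
theorem stmt_15 (n : ℕ) (hn : 5 ≤ n) (lam : ℝ)
    (hlam : lam > (n : ℝ) ^ 3 * ((n : ℝ) - 4) / 16) :
    ¬ ∃ u : EuclideanSpace ℝ (Fin n) → ℝ,
      ContDiff ℝ (⊤ : ℕ∞) u ∧
      (∀ x ∈ closedBall (0 : EuclideanSpace ℝ (Fin n)) 1, 0 < u x) ∧
      (∃ φ : ℝ → ℝ, ContDiff ℝ (⊤ : ℕ∞) φ ∧ ∀ x, u x = φ ‖x‖) ∧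
      (∀ x ∈ ball (0 : EuclideanSpace ℝ (Fin n)) 1,
        laplacian (laplacian u) x = lam * u x ^ (((n : ℝ) + 4) / ((n : ℝ) - 4))) ∧
      (∀ x ∈ sphere (0 : EuclideanSpace ℝ (Fin n)) 1, u x = 1) ∧
      (∀ x ∈ sphere (0 : EuclideanSpace ℝ (Fin n)) 1,
        fderiv ℝ u x x = -(((n : ℝ) - 4) / 2)) := by
  rintro ⟨u, hu, hpos, ⟨φ, hφ, huφ⟩, heq, hbdry, hnormal⟩
  have hle : (2 : WithTop ℕ∞) ≤ ((⊤ : ℕ∞) : WithTop ℕ∞) :=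
    WithTop.coe_le_coe.mpr (le_top : (2 : ℕ∞) ≤ ⊤)
  have hφ2 : ContDiff ℝ 2 φ := hφ.of_le hle
  set e : EuclideanSpace ℝ (Fin n) := EuclideanSpace.single ⟨0, by omega⟩ 1 with he
  have hnorm : ∀ r : ℝ, 0 ≤ r → ‖r • e‖ = r := fun r hr => by
    simp [he, norm_smul, abs_of_nonneg hr]
  have hne : ∀ r : ℝ, 0 < r → r • e ≠ 0 := fun r hr => by
    rw [← norm_pos_iff, hnorm r hr.le]
    exact hr
  have hlap := contDiff_laplacian hu
  set w : ℝ → ℝ := fun r => laplacian u (r • e) with hw_def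
  have hw : ContDiff ℝ 2 w :=
    (hlap.comp (contDiff_id.smul contDiff_const)).of_le hle
  have hlapw : ∀ x, laplacian u x = w ‖x‖ := by
    intro x
    rcases eq_or_ne x 0 with rfl | hx
    · simp [hw_def]
    · have hx' := hne ‖x‖ (norm_pos_iff.mpr hx)
      simp only [hw_def]
      rw [laplacian_of_radial (hu.of_le hle) hφ2 huφ hx,
        laplacian_of_radial (hu.of_le hle) hφ2 huφ hx', hnorm _ (norm_nonneg x)]
  have hE : pohozaevEnergy n lam φ w 1 = 0 := by
    refine pohozaevEnergy_one_eq_zero hn hφ2 hw ?_ ?_ ?_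
    · intro r hr
      have h := hpos (r • e) (by simpa [hnorm r hr.1] using hr.2)
      rwa [huφ, hnorm r hr.1] at h
    · intro r hr
      have h := laplacian_of_radial (hu.of_le hle) hφ2 huφ (hne r hr.1)
      rwa [hnorm r hr.1.le] at h
    · intro r hr
      have h := heq (r • e) (by simpa [hnorm r hr.1.le] using hr.2)
      rwa [laplacian_of_radial (hlap.of_le hle) hw hlapw (hne r hr.1), huφ,
        hnorm r hr.1.le] at h
  have he1 : ‖e‖ = 1 := by simpa using hnorm 1 zero_le_one
  have he0 : e ≠ 0 := by simpa using hne 1 one_pos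
  have hφ1 : φ 1 = 1 := by
    have h := hbdry e (by simpa using he1)
    rwa [huφ, he1] at h
  have hφ1' : deriv φ 1 = -(((n : ℝ) - 4) / 2) := by
    have h := hnormal e (by simpa using he1)
    obtain rfl : u = fun y => φ ‖y‖ := funext huφ
    rw [((hφ2.differentiable two_ne_zero ‖e‖).hasDerivAt.hasFDerivAt_comp_norm he0).fderiv] at h
    simpa [he1] using h
  have hn5 : (5 : ℝ) ≤ n := by exact_mod_cast hn
  simp only [pohozaevEnergy, hφ1, hφ1', one_pow, Real.one_rpow, one_mul, mul_one] at hE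
  have hquad : w 1 ^ 2 + n * ((n : ℝ) - 4) / 2 * w 1 + lam * (((n : ℝ) - 4) / n) = 0 := by
    have h2 : ((n : ℝ) - 4) / (2 * n) = ((n : ℝ) - 4) / n / 2 := by
      field_simp
    rw [h2] at hE
    linear_combination (-2) * hE
  have hgap : ((n : ℝ) * ((n : ℝ) - 4) / 4) ^ 2 < lam * (((n : ℝ) - 4) / n) := by
    have hq : 0 < ((n : ℝ) - 4) / n := div_pos (by linarith) (by linarith)
    refine lt_of_eq_of_lt ?_ (mul_lt_mul_of_pos_right hlam hq)
    have : (n : ℝ) ≠ 0 := by linarith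
    field_simp
    ring
  nlinarith [sq_nonneg (w 1 + n * ((n : ℝ) - 4) / 4)]
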